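/- There exist a continuous Li-Yorke non-chaotic map f : [0,1] → [0,1] of type 2^∞ with a unique infinite minimal set C, and sequences (ε_k) and (ε'_k) decreasing to zero, such that for every x ∈ C: DET_∞(x, ε_k) = 1 for every k, and limsup-determinism DET̄_∞(x, ε'_k) ≤ 2^{1−k} for every k. Consequently limsup_{ε→0} DET̲_∞(x,ε) = 1 and liminf_{ε→0} DET̄_∞(x,ε) = 0 for every x ∈ C. -/

import Mathlib

open Filter Metric Set
open scoped Classical

namespace RQA

variable {X : Type*} [MetricSpace X]

/-- Correlation sum `C_m(x,n,ε)` with respect to the Bowen metric `ρ_m`: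
`ρ_m(f^[i] x, f^[j] x) ≤ ε ↔ ∀ k < m, dist (f^[i+k] x) (f^[j+k] x) ≤ ε`. -/
noncomputable def corrSum (f : X → X) (x : X) (m n : ℕ) (ε : ℝ) : ℝ :=
  (((Finset.range n ×ˢ Finset.range n).filter
      (fun p => ∀ k < m, dist (f^[p.1 + k] x) (f^[p.2 + k] x) ≤ ε)).card : ℝ) / (n : ℝ) ^ 2

/-- Correlation sum `C_∞(x,n,ε)` with respect to the metric `ρ_∞`. -/
noncomputable def corrSumInf (f : X → X) (x : X) (n : ℕ) (ε : ℝ) : ℝ :=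
  (((Finset.range n ×ˢ Finset.range n).filter
      (fun p => ∀ k : ℕ, dist (f^[p.1 + k] x) (f^[p.2 + k] x) ≤ ε)).card : ℝ) / (n : ℝ) ^ 2

/-- Lower asymptotic correlation sum `C̲_m(x,ε)`. -/
noncomputable def lowerCorr (f : X → X) (x : X) (m : ℕ) (ε : ℝ) : ℝ :=
  liminf (fun n => corrSum f x m n ε) atTop

/-- Upper asymptotic correlation sum `C̄_m(x,ε)`. -/
noncomputable def upperCorr (f : X → X) (x : X) (m : ℕ) (ε : ℝ) : ℝ :=
  limsup (fun n => corrSum f x m n ε) atTop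

/-- Recurrence `m`-determinism `DET_m(x,n,ε) = C_m(x,n,ε)/C_1(x,n,ε)`. -/
noncomputable def detSum (f : X → X) (x : X) (m n : ℕ) (ε : ℝ) : ℝ :=
  corrSum f x m n ε / corrSum f x 1 n ε

/-- Recurrence `∞`-determinism `DET_∞(x,n,ε) = C_∞(x,n,ε)/C_1(x,n,ε)`. -/
noncomputable def detSumInf (f : X → X) (x : X) (n : ℕ) (ε : ℝ) : ℝ :=
  corrSumInf f x n ε / corrSum f x 1 n ε

/-- Lower asymptotic recurrence determinism `DET̲_m(x,ε)`. -/
noncomputable def lowerDet (f : X → X) (x : X) (m : ℕ) (ε : ℝ) : ℝ :=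
  liminf (fun n => detSum f x m n ε) atTop

/-- Upper asymptotic recurrence determinism `DET̄_m(x,ε)`. -/
noncomputable def upperDet (f : X → X) (x : X) (m : ℕ) (ε : ℝ) : ℝ :=
  limsup (fun n => detSum f x m n ε) atTop

/-- `C̄_∞(x,ε) = lim_m C̄_m(x,ε)`; since `m ↦ C̄_m(x,ε)` is non-increasing,
the limit equals the infimum over `m ≥ 1`. -/
noncomputable def upperCorrInf (f : X → X) (x : X) (ε : ℝ) : ℝ :=
  ⨅ m : ℕ, upperCorr f x (m + 1) ε

/-- `C̲_∞(x,ε) = lim_m C̲_m(x,ε)` (a limit of a non-increasing sequence). -/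
noncomputable def lowerCorrInf (f : X → X) (x : X) (ε : ℝ) : ℝ :=
  ⨅ m : ℕ, lowerCorr f x (m + 1) ε

/-- `DET̄_∞(x,ε) = lim_m DET̄_m(x,ε)` (a limit of a non-increasing sequence). -/
noncomputable def upperDetInf (f : X → X) (x : X) (ε : ℝ) : ℝ :=
  ⨅ m : ℕ, upperDet f x (m + 1) ε

/-- `DET̲_∞(x,ε) = lim_m DET̲_m(x,ε)` (a limit of a non-increasing sequence). -/
noncomputable def lowerDetInf (f : X → X) (x : X) (ε : ℝ) : ℝ :=
  ⨅ m : ℕ, lowerDet f x (m + 1) ε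

/-- The ω-limit set of `x`: the set of limit points of the trajectory `(f^[n] x)`. -/
def omegaSet (f : X → X) (x : X) : Set X :=
  {y | ∃ φ : ℕ → ℕ, StrictMono φ ∧ Tendsto (fun n => f^[φ n] x) atTop (nhds y)}

/-- Distance between two subsets of `ℝ`. -/
noncomputable def setDist (A B : Set ℝ) : ℝ :=
  sInf {d | ∃ a ∈ A, ∃ b ∈ B, d = dist a b}

/-- The binary word of length `t` given by the binary digits of `n`
(the 2-adic encoding, least significant digit first; addition of integers to
words is addition with carry from left to right, i.e. ordinary addition of the
encoded values modulo `2^t`). -/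
def word (t n : ℕ) : Fin t → Bool := fun i => n.testBit i.val

/-- The value `∑ w_i 2^i` of a binary word under the 2-adic encoding. -/
def encodeWord {t : ℕ} (w : Fin t → Bool) : ℕ :=
  ∑ i : Fin t, if w i then 2 ^ i.val else 0

end RQA

open RQA


structure Par where
  a : ℕ → ℝ
  b : ℕ → ℝ
  a_pos : ∀ k, 0 < a k
  a_le : ∀ k, a k ≤ 1 / 4
  b_pos : ∀ k, 0 < b k
  b_le : ∀ k, b k ≤ a k

namespace Par

variable (p : Par)

lemma b_le' (k : ℕ) : p.b k ≤ 1 / 4 := (p.b_le k).trans (p.a_le k)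

noncomputable def top (k : ℕ) : ℝ := 1 - p.a k * (1 - p.b (k + 1))

noncomputable def lam (k : ℕ) : ℝ := p.top k / (1 - p.a k - p.b k)

noncomputable def P (k : ℕ) (x : ℝ) : ℝ :=
  max 0 (min (p.top k - p.b k + p.b k / p.a k * x) ((1 - p.b k - x) * p.lam k))

noncomputable def s (k : ℕ) (x : ℝ) : ℝ := max 0 ((x - 1 + p.b k) / p.b k)

noncomputable def term : ℕ → ℕ → ℝ → ℝ
  | k, 0, x => p.P k x
  | k, j + 1, x => p.a k * term (k + 1) j (p.s k x)

noncomputable def f (k : ℕ) (x : ℝ) : ℝ := ∑' j, p.term k j x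

lemma den_pos (k : ℕ) : 1 / 2 ≤ 1 - p.a k - p.b k := by
  have := p.a_le k; have := p.b_le' k; linarith

lemma top_mem (k : ℕ) : 3 / 4 ≤ p.top k ∧ p.top k ≤ 1 := by
  have h1 := p.a_le k; have h2 := p.b_le' (k+1); have h3 := p.a_pos k; have h4 := p.b_pos (k+1)
  unfold top
  constructor <;> nlinarith

lemma lam_gt (k : ℕ) : 1 < p.lam k := by
  unfold lam
  rw [one_lt_div (by have := p.den_pos k; linarith)]
  have h3 := p.a_pos k; have h4 := p.b_pos (k+1); have := p.b_pos k
  unfold top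
  nlinarith

lemma lam_mul (k : ℕ) : (1 - p.a k - p.b k) * p.lam k = p.top k := by
  unfold lam
  have := p.den_pos k
  field_simp

lemma P_nonneg (k : ℕ) (x : ℝ) : 0 ≤ p.P k x := le_max_left _ _

lemma P_le (k : ℕ) (x : ℝ) : p.P k x ≤ p.top k := by
  have ht := p.top_mem k
  have hl := p.lam_gt k
  have ha := p.a_pos k
  have hb := p.b_pos k
  refine max_le (by linarith) ?_
  rcases le_total x (p.a k) with h | h
  · refine (min_le_left _ _).trans ?_
    have : p.b k / p.a k * x ≤ p.b k := by
      rw [div_mul_eq_mul_div, div_le_iff₀ ha]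
      nlinarith
    linarith
  · refine (min_le_right _ _).trans ?_
    rw [← p.lam_mul k]
    nlinarith

lemma P_left (k : ℕ) {u : ℝ} (h0 : 0 ≤ u) (h1 : u ≤ 1) :
    p.P k (p.a k * u) = p.top k - p.b k + p.b k * u := by
  have ht := p.top_mem k
  have hl := p.lam_gt k
  have ha := p.a_pos k
  have hb := p.b_pos k
  have hb' := p.b_le' k
  have e : p.b k / p.a k * (p.a k * u) = p.b k * u := by field_simp
  unfold P
  rw [e, min_eq_left, max_eq_right]
  · nlinarith
  · have := p.lam_mul k
    have h2 : 0 ≤ (1 - u) * (p.a k * p.lam k) := by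
      apply mul_nonneg; linarith; nlinarith
    nlinarith

lemma P_mid (k : ℕ) {x : ℝ} (h0 : p.a k ≤ x) (h1 : x ≤ 1 - p.b k) :
    p.P k x = (1 - p.b k - x) * p.lam k := by
  have ht := p.top_mem k
  have hl := p.lam_gt k
  have ha := p.a_pos k
  have hb := p.b_pos k
  have : p.b k ≤ p.b k / p.a k * x := by
    rw [div_mul_eq_mul_div, le_div_iff₀ ha]
    nlinarith
  unfold P
  rw [min_eq_right, max_eq_right]
  · apply mul_nonneg <;> linarith
  · have := p.lam_mul k
    nlinarith

lemma P_right (k : ℕ) {x : ℝ} (h1 : 1 - p.b k ≤ x) : p.P k x = 0 := by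
  have hl := p.lam_gt k
  unfold P
  apply max_eq_left
  refine (min_le_right _ _).trans ?_
  nlinarith

lemma s_left (k : ℕ) {x : ℝ} (h : x ≤ 1 - p.b k) : p.s k x = 0 := by
  unfold s
  apply max_eq_left
  exact div_nonpos_of_nonpos_of_nonneg (by linarith) (p.b_pos k).le

lemma s_right (k : ℕ) {u : ℝ} (h : 0 ≤ u) : p.s k (1 - p.b k + p.b k * u) = u := by
  unfold s
  have := p.b_pos k
  have e : (1 - p.b k + p.b k * u - 1 + p.b k) / p.b k = u := by field_simp; ring
  rw [e]; exact max_eq_right h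

lemma term_nonneg (k j : ℕ) (x : ℝ) : 0 ≤ p.term k j x := by
  induction j generalizing k x with
  | zero => exact p.P_nonneg k x
  | succ j ih => exact mul_nonneg (p.a_pos k).le (ih _ _)

lemma term_le (k j : ℕ) (x : ℝ) : p.term k j x ≤ (1 / 4) ^ j := by
  induction j generalizing k x with
  | zero => rw [pow_zero]; exact (p.P_le k x).trans (p.top_mem k).2
  | succ j ih =>
    rw [pow_succ']
    exact mul_le_mul (p.a_le k) (ih _ _) (p.term_nonneg _ _ _) (by norm_num)

lemma geo : Summable (fun j : ℕ => (1 / 4 : ℝ) ^ j) :=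
  summable_geometric_of_lt_one (by norm_num) (by norm_num)

lemma term_summable (k : ℕ) (x : ℝ) : Summable (fun j => p.term k j x) :=
  Summable.of_nonneg_of_le (fun j => p.term_nonneg k j x) (fun j => p.term_le k j x) geo

lemma P_cont (k : ℕ) : Continuous (p.P k) := by
  unfold P; fun_prop

lemma s_cont (k : ℕ) : Continuous (p.s k) := by
  unfold s; fun_prop

lemma term_cont (k j : ℕ) : Continuous (p.term k j) := by
  induction j generalizing k with
  | zero => exact p.P_cont k
  | succ j ih => exact continuous_const.mul ((ih (k+1)).comp (p.s_cont k))

lemma f_cont (k : ℕ) : Continuous (p.f k) := by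
  refine continuous_tsum (fun j => p.term_cont k j) geo (fun j x => ?_)
  rw [Real.norm_of_nonneg (p.term_nonneg k j x)]
  exact p.term_le k j x

lemma f_eq (k : ℕ) (x : ℝ) : p.f k x = p.P k x + p.a k * p.f (k + 1) (p.s k x) := by
  unfold f
  rw [(p.term_summable k x).tsum_eq_zero_add, ← tsum_mul_left]
  rfl

lemma f_nonneg (k : ℕ) (x : ℝ) : 0 ≤ p.f k x := tsum_nonneg (fun j => p.term_nonneg k j x)

lemma f_le_two (k : ℕ) (x : ℝ) : p.f k x ≤ 2 := by
  have : p.f k x ≤ ∑' j : ℕ, (1 / 4 : ℝ) ^ j :=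
    (p.term_summable k x).tsum_le_tsum (fun j => p.term_le k j x) geo
  rw [tsum_geometric_of_lt_one (by norm_num) (by norm_num)] at this
  norm_num at this
  linarith

lemma f_zero_aux (n k : ℕ) : |p.f k 0 - (1 - p.b k)| ≤ 2 * (1 / 4) ^ n := by
  induction n generalizing k with
  | zero =>
    have := p.f_nonneg k 0; have := p.f_le_two k 0; have := p.b_pos k; have := p.b_le' k
    rw [abs_le]; constructor <;> norm_num <;> linarith
  | succ n ih =>
    have h := ih (k + 1)
    have e : p.f k 0 - (1 - p.b k) = p.a k * (p.f (k+1) 0 - (1 - p.b (k + 1))) := by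
      rw [p.f_eq k 0, p.s_left k (by have := p.b_le' k; linarith)]
      have := p.P_left k (u := 0) le_rfl zero_le_one
      rw [mul_zero, mul_zero] at this
      rw [this]; unfold top; ring
    rw [e, abs_mul, abs_of_pos (p.a_pos k), pow_succ']
    calc p.a k * _ ≤ 1 / 4 * (2 * (1 / 4) ^ n) :=
          mul_le_mul (p.a_le k) h (abs_nonneg _) (by norm_num)
      _ = _ := by ring

lemma f_zero (k : ℕ) : p.f k 0 = 1 - p.b k := by
  have h : Tendsto (fun n : ℕ => 2 * (1 / 4 : ℝ) ^ n) atTop (nhds (2 * 0)) :=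
    (tendsto_pow_atTop_nhds_zero_of_lt_one (by norm_num) (by norm_num)).const_mul 2
  have h2 := ge_of_tendsto' h (fun n => p.f_zero_aux n k)
  rw [mul_zero] at h2
  have := abs_eq_zero.1 (le_antisymm h2 (abs_nonneg _))
  linarith

lemma f_left (k : ℕ) {x : ℝ} (h : x ≤ 1 - p.b k) : p.f k x = p.P k x + 1 - p.top k := by
  rw [p.f_eq, p.s_left k h, p.f_zero]; unfold top; ring

lemma f_E1 (k : ℕ) {u : ℝ} (h0 : 0 ≤ u) (h1 : u ≤ 1) :
    p.f k (p.a k * u) = 1 - p.b k + p.b k * u := by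
  have := p.a_le k; have := p.b_le' k; have := p.a_pos k
  rw [p.f_left k (by nlinarith), p.P_left k h0 h1]; ring

lemma f_E2 (k : ℕ) {u : ℝ} (h0 : 0 ≤ u) :
    p.f k (1 - p.b k + p.b k * u) = p.a k * p.f (k + 1) u := by
  have := p.b_pos k
  rw [p.f_eq, p.P_right k (by nlinarith), p.s_right k h0, zero_add]

lemma f_E3 (k : ℕ) {x : ℝ} (h0 : p.a k ≤ x) (h1 : x ≤ 1 - p.b k) :
    p.f k x = 1 - p.lam k * (x - p.a k) := by
  rw [p.f_left k h1, p.P_mid k h0 h1]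
  linear_combination p.lam_mul k

lemma f_le_one (k : ℕ) (x : ℝ) : p.f k x ≤ 1 := by
  rcases le_total x (1 - p.b k) with h | h
  · rw [p.f_left k h]; linarith [p.P_le k x]
  · rw [p.f_eq, p.P_right k h]
    have := p.f_le_two (k+1) (p.s k x); have := p.f_nonneg (k+1) (p.s k x)
    have := p.a_le k; have := p.a_pos k
    nlinarith

lemma f_mem (k : ℕ) (x : ℝ) : p.f k x ∈ Icc (0 : ℝ) 1 := ⟨p.f_nonneg k x, p.f_le_one k x⟩

/-- fixed point in the middle -/
noncomputable def fp (k : ℕ) : ℝ := (1 + p.lam k * p.a k) / (1 + p.lam k)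

lemma fp_eq (k : ℕ) : p.fp k * (1 + p.lam k) = 1 + p.lam k * p.a k := by
  unfold fp
  have := p.lam_gt k
  field_simp

lemma fp_mid (k : ℕ) : p.a k ≤ p.fp k ∧ p.fp k ≤ 1 - p.b k := by
  have hl := p.lam_gt k
  have ha := p.a_pos k
  have ha' := p.a_le k
  have hb' := p.b_le' k
  have hb := p.b_pos k
  have h4 := p.b_pos (k+1)
  have h5 := p.lam_mul k
  unfold top at h5
  unfold fp
  constructor
  · rw [le_div_iff₀ (by linarith)]; nlinarith
  · rw [div_le_iff₀ (by linarith)]; nlinarith [p.b_le' (k+1)]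

lemma fp_fix (k : ℕ) : p.f k (p.fp k) = p.fp k := by
  rw [p.f_E3 k (p.fp_mid k).1 (p.fp_mid k).2]
  have := p.fp_eq k
  linarith

lemma fp_mem (k : ℕ) : p.fp k ∈ Icc (0 : ℝ) 1 := by
  rw [← p.fp_fix]; exact p.f_mem _ _

lemma middle (k : ℕ) (u : ℝ) : (∃ s, (p.f k)^[s] u = p.fp k) ∨
    ∃ s, (p.f k)^[s] u ≤ p.a k ∨ 1 - p.b k ≤ (p.f k)^[s] u := by
  by_contra! hcon
  obtain ⟨h1, h2⟩ := hcon
  have key : ∀ s, |(p.f k)^[s] u - p.fp k| = p.lam k ^ s * |u - p.fp k| := by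
    intro s
    induction s with
    | zero => simp
    | succ s ih =>
      rw [Function.iterate_succ_apply', p.f_E3 k (h2 s).1.le (h2 s).2.le, pow_succ', mul_assoc,
        ← ih, ← abs_of_pos (show 0 < p.lam k by linarith [p.lam_gt k]), ← abs_mul,
        abs_of_pos (show 0 < p.lam k by linarith [p.lam_gt k])]
      rw [← abs_neg]
      congr 1
      linear_combination p.fp_eq k
  have hpos : 0 < |u - p.fp k| := abs_pos.2 (sub_ne_zero.2 (h1 0))
  have ht := (tendsto_pow_atTop_atTop_of_one_lt (p.lam_gt k)).atTop_mul_const hpos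
  obtain ⟨s, hs⟩ := (ht.eventually_gt_atTop 1).exists
  rw [← key] at hs
  have := h2 s
  have h3 := p.fp_mem k
  have := p.a_pos k
  have := p.b_pos k
  have : |(p.f k)^[s] u - p.fp k| ≤ 1 := by
    rw [abs_le]; constructor <;> linarith [h3.1, h3.2]
  linarith

end Par


namespace Par

variable (p : Par)

noncomputable def psi : ℕ → ℕ → ℕ → ℝ → ℝ
  | _, 0, _, u => u
  | k, n + 1, i, u => if i % 2 = 0 then p.a k * psi (k + 1) n (i / 2) u
      else 1 - p.b k + p.b k * psi (k + 1) n (i / 2) u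

noncomputable def len : ℕ → ℕ → ℕ → ℝ
  | _, 0, _ => 1
  | k, n + 1, i => (if i % 2 = 0 then p.a k else p.b k) * len (k + 1) n (i / 2)

lemma psi_even (k n : ℕ) {i : ℕ} (u : ℝ) (h : i % 2 = 0) :
    p.psi k (n + 1) i u = p.a k * p.psi (k + 1) n (i / 2) u := by
  simp [psi, h]

lemma psi_odd (k n : ℕ) {i : ℕ} (u : ℝ) (h : i % 2 = 1) :
    p.psi k (n + 1) i u = 1 - p.b k + p.b k * p.psi (k + 1) n (i / 2) u := by
  simp [psi, h]

lemma len_even (k n : ℕ) {i : ℕ} (h : i % 2 = 0) :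
    p.len k (n + 1) i = p.a k * p.len (k + 1) n (i / 2) := by
  simp [len, h]

lemma len_odd (k n : ℕ) {i : ℕ} (h : i % 2 = 1) :
    p.len k (n + 1) i = p.b k * p.len (k + 1) n (i / 2) := by
  simp [len, h]

lemma psi_mem (k n i : ℕ) {u : ℝ} (hu : u ∈ Icc (0 : ℝ) 1) : p.psi k n i u ∈ Icc (0 : ℝ) 1 := by
  induction n generalizing k i with
  | zero => exact hu
  | succ n ih =>
    have h := ih (k + 1) (i / 2)
    have := p.a_pos k; have := p.a_le k; have := p.b_pos k; have := p.b_le' k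
    rcases Nat.mod_two_eq_zero_or_one i with hi | hi
    · rw [p.psi_even _ _ _ hi]
      constructor <;> nlinarith [h.1, h.2]
    · rw [p.psi_odd _ _ _ hi]
      constructor <;> nlinarith [h.1, h.2]

lemma mod_half {n i j : ℕ} (h : i % 2 ^ (n + 1) = j % 2 ^ (n + 1)) :
    i % 2 = j % 2 ∧ (i / 2) % 2 ^ n = (j / 2) % 2 ^ n := by
  constructor
  · have := congrArg (· % 2) h
    simpa [pow_succ, Nat.mod_mul_left_mod] using this
  · have := congrArg (· / 2) h
    simpa [pow_succ, Nat.mod_mul_left_div_self] using this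

lemma half_mod {n i j : ℕ} (h1 : i % 2 = j % 2) (h2 : (i / 2) % 2 ^ n = (j / 2) % 2 ^ n) :
    i % 2 ^ (n + 1) = j % 2 ^ (n + 1) := by
  rw [pow_succ', Nat.mod_mul, Nat.mod_mul, h1, h2]

lemma psi_mod (k n : ℕ) {i j : ℕ} (u : ℝ) (h : i % 2 ^ n = j % 2 ^ n) :
    p.psi k n i u = p.psi k n j u := by
  induction n generalizing k i j with
  | zero => rfl
  | succ n ih =>
    obtain ⟨h1, h2⟩ := mod_half h
    have := ih (k + 1) h2
    simp only [psi, h1, this]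

lemma f_psi (k n i : ℕ) {u : ℝ} (hu : u ∈ Icc (0 : ℝ) 1) :
    p.f k (p.psi k n i u) = p.psi k n (i + 1) (if (i + 1) % 2 ^ n = 0 then p.f (k + n) u else u) := by
  induction n generalizing k i with
  | zero => simp [psi, Nat.mod_one]
  | succ n ih =>
    have hm := p.psi_mem (k + 1) n (i / 2) hu
    rcases Nat.mod_two_eq_zero_or_one i with hi | hi
    · rw [p.psi_even _ _ _ hi, p.f_E1 k hm.1 hm.2, p.psi_odd _ _ _ (by omega : (i + 1) % 2 = 1),
        show (i + 1) / 2 = i / 2 by omega, if_neg]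
      intro h
      have : (2 : ℕ) ∣ i + 1 := (dvd_pow_self 2 (Nat.succ_ne_zero n)).trans (Nat.dvd_of_mod_eq_zero h)
      omega
    · rw [p.psi_odd _ _ _ hi, p.f_E2 k hm.1, ih, p.psi_even _ _ _ (by omega : (i + 1) % 2 = 0),
        show (i + 1) / 2 = i / 2 + 1 by omega, show k + 1 + n = k + (n + 1) by ring]
      congr 2
      have : (i + 1) % 2 ^ (n + 1) = 0 ↔ (i / 2 + 1) % 2 ^ n = 0 := by
        rw [pow_succ', Nat.mod_mul, show (i + 1) / 2 = i / 2 + 1 by omega]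
        omega
      simp only [this]

lemma iter_psi (k n i j : ℕ) {u : ℝ} (hu : u ∈ Icc (0 : ℝ) 1) :
    ∃ v ∈ Icc (0 : ℝ) 1, (p.f k)^[j] (p.psi k n i u) = p.psi k n (i + j) v := by
  induction j with
  | zero => exact ⟨u, hu, rfl⟩
  | succ j ih =>
    obtain ⟨v, hv, h⟩ := ih
    refine ⟨_, ?_, by rw [Function.iterate_succ_apply', h, p.f_psi k n _ hv]; rfl⟩
    split_ifs
    · exact p.f_mem _ _
    · exact hv

lemma iter_psi_fp (n i j : ℕ) :
    (p.f 0)^[j] (p.psi 0 n i (p.fp n)) = p.psi 0 n (i + j) (p.fp n) := by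
  induction j with
  | zero => rfl
  | succ j ih =>
    rw [Function.iterate_succ_apply', ih, p.f_psi 0 n _ (p.fp_mem n), Nat.zero_add, p.fp_fix, ite_self]
    rfl

lemma iter_lt (n j : ℕ) (hj : j < 2 ^ n) {u : ℝ} (hu : u ∈ Icc (0 : ℝ) 1) :
    (p.f 0)^[j] (p.psi 0 n 0 u) = p.psi 0 n j u := by
  induction j with
  | zero => rfl
  | succ j ih =>
    rw [Function.iterate_succ_apply', ih (by omega), p.f_psi 0 n _ hu, if_neg]
    rw [Nat.mod_eq_of_lt hj]; omega

lemma iter_pow (n : ℕ) {u : ℝ} (hu : u ∈ Icc (0 : ℝ) 1) :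
    (p.f 0)^[2 ^ n] (p.psi 0 n 0 u) = p.psi 0 n 0 (p.f n u) := by
  have h : 2 ^ n = (2 ^ n - 1) + 1 := by have := Nat.one_le_two_pow (n := n); omega
  have h2 : 2 ^ n - 1 < 2 ^ n := by have := Nat.one_le_two_pow (n := n); omega
  conv_lhs => rw [h]
  rw [Function.iterate_succ_apply', p.iter_lt n _ h2 hu, p.f_psi 0 n _ hu, ← h, if_pos (Nat.mod_self _),
    Nat.zero_add]
  exact p.psi_mod 0 n _ (by simp)

lemma iter_mul_pow (n s : ℕ) {u : ℝ} (hu : u ∈ Icc (0 : ℝ) 1) :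
    (p.f 0)^[2 ^ n * s] (p.psi 0 n 0 u) = p.psi 0 n 0 ((p.f n)^[s] u) := by
  induction s generalizing u with
  | zero => rfl
  | succ s ih =>
    rw [Nat.mul_succ, Function.iterate_add_apply, p.iter_pow n hu, ih (p.f_mem _ _)]
    rfl

lemma psi_succ (k n i : ℕ) (u : ℝ) : p.psi k (n + 1) i u =
    p.psi k n i (if (i / 2 ^ n) % 2 = 0 then p.a (k + n) * u else 1 - p.b (k + n) + p.b (k + n) * u) := by
  induction n generalizing k i with
  | zero => simp [psi]
  | succ n ih =>
    have e : i / 2 / 2 ^ n = i / 2 ^ (n + 1) := by rw [Nat.div_div_eq_div_mul, pow_succ']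
    rcases Nat.mod_two_eq_zero_or_one i with hi | hi
    · rw [p.psi_even _ (n + 1) _ hi, p.psi_even _ n _ hi, ih, e, show k + 1 + n = k + (n + 1) by ring]
    · rw [p.psi_odd _ (n + 1) _ hi, p.psi_odd _ n _ hi, ih, e, show k + 1 + n = k + (n + 1) by ring]

lemma psi_trunc (k n d i : ℕ) {u : ℝ} (hu : u ∈ Icc (0 : ℝ) 1) :
    ∃ v ∈ Icc (0 : ℝ) 1, p.psi k (n + d) i u = p.psi k n i v := by
  induction d generalizing u with
  | zero => exact ⟨u, hu, rfl⟩
  | succ d ih =>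
    rw [← Nat.add_assoc, p.psi_succ]
    apply ih
    have := p.a_pos (k + (n + d)); have := p.a_le (k + (n + d))
    have := p.b_pos (k + (n + d)); have := p.b_le' (k + (n + d))
    split_ifs
    · constructor <;> nlinarith [hu.1, hu.2]
    · constructor <;> nlinarith [hu.1, hu.2]

lemma len_pos (k n i : ℕ) : 0 < p.len k n i := by
  induction n generalizing k i with
  | zero => exact one_pos
  | succ n ih =>
    have := ih (k + 1) (i / 2)
    have := p.a_pos k; have := p.b_pos k
    unfold len
    split_ifs <;> positivity

lemma psi_close (k n i : ℕ) {u v : ℝ} (hu : u ∈ Icc (0 : ℝ) 1) (hv : v ∈ Icc (0 : ℝ) 1) :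
    |p.psi k n i u - p.psi k n i v| ≤ p.len k n i := by
  induction n generalizing k i with
  | zero =>
    show |u - v| ≤ 1
    rw [abs_le]; constructor <;> linarith [hu.1, hu.2, hv.1, hv.2]
  | succ n ih =>
    have h := ih (k + 1) (i / 2)
    rcases Nat.mod_two_eq_zero_or_one i with hi | hi
    · rw [p.psi_even _ _ _ hi, p.psi_even _ _ _ hi, p.len_even _ _ hi, ← mul_sub, abs_mul,
        abs_of_pos (p.a_pos k)]
      exact mul_le_mul_of_nonneg_left h (p.a_pos k).le
    · rw [p.psi_odd _ _ _ hi, p.psi_odd _ _ _ hi, p.len_odd _ _ hi, add_sub_add_left_eq_sub,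
        ← mul_sub, abs_mul, abs_of_pos (p.b_pos k)]
      exact mul_le_mul_of_nonneg_left h (p.b_pos k).le

lemma psi_sep (k n : ℕ) {i j : ℕ} {u v : ℝ} (hu : u ∈ Icc (0 : ℝ) 1) (hv : v ∈ Icc (0 : ℝ) 1)
    (h1 : i % 2 ^ n = j % 2 ^ n) (h2 : i % 2 ^ (n + 1) ≠ j % 2 ^ (n + 1)) :
    p.len k n i / 2 ≤ |p.psi k (n + 1) i u - p.psi k (n + 1) j v| := by
  induction n generalizing k i j with
  | zero =>
    have ha := p.a_pos k; have ha' := p.a_le k; have hb := p.b_pos k; have hb' := p.b_le' k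
    rcases Nat.mod_two_eq_zero_or_one i with hi | hi <;>
    rcases Nat.mod_two_eq_zero_or_one j with hj | hj
    · simp [hi, hj] at h2
    · rw [p.psi_even _ _ _ hi, p.psi_odd _ _ _ hj]
      simp only [psi, len]
      rw [abs_sub_comm]
      refine le_trans ?_ (le_abs_self _)
      nlinarith [hu.1, hu.2, hv.1, hv.2]
    · rw [p.psi_odd _ _ _ hi, p.psi_even _ _ _ hj]
      simp only [psi, len]
      refine le_trans ?_ (le_abs_self _)
      nlinarith [hu.1, hu.2, hv.1, hv.2]
    · simp [hi, hj] at h2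
  | succ n ih =>
    obtain ⟨h3, h4⟩ := mod_half h1
    have h5 : (i / 2) % 2 ^ (n + 1) ≠ (j / 2) % 2 ^ (n + 1) := fun h => h2 (half_mod h3 h)
    have h := ih (k + 1) h4 h5
    rcases Nat.mod_two_eq_zero_or_one i with hi | hi
    · have hj : j % 2 = 0 := h3 ▸ hi
      rw [p.psi_even k (n + 1) _ hi, p.psi_even k (n + 1) _ hj, p.len_even _ _ hi, ← mul_sub, abs_mul,
        abs_of_pos (p.a_pos k), mul_div_assoc]
      exact mul_le_mul_of_nonneg_left h (p.a_pos k).le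
    · have hj : j % 2 = 1 := h3 ▸ hi
      rw [p.psi_odd k (n + 1) _ hi, p.psi_odd k (n + 1) _ hj, p.len_odd _ _ hi, add_sub_add_left_eq_sub,
        ← mul_sub, abs_mul, abs_of_pos (p.b_pos k), mul_div_assoc]
      exact mul_le_mul_of_nonneg_left h (p.b_pos k).le

/-- first level of disagreement -/
lemma exists_level {N i j : ℕ} (h : i % 2 ^ N ≠ j % 2 ^ N) :
    ∃ n < N, i % 2 ^ n = j % 2 ^ n ∧ i % 2 ^ (n + 1) ≠ j % 2 ^ (n + 1) := by
  induction N with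
  | zero => simp [Nat.mod_one] at h
  | succ N ih =>
    by_cases h' : i % 2 ^ N = j % 2 ^ N
    · exact ⟨N, by omega, h', h⟩
    · obtain ⟨n, hn, h3⟩ := ih h'
      exact ⟨n, by omega, h3⟩

/-- general separation for level `N` -/
lemma psi_sep' (N : ℕ) {i j : ℕ} {u v : ℝ} (hu : u ∈ Icc (0 : ℝ) 1) (hv : v ∈ Icc (0 : ℝ) 1)
    {n : ℕ} (hn : n < N)
    (h1 : i % 2 ^ n = j % 2 ^ n) (h2 : i % 2 ^ (n + 1) ≠ j % 2 ^ (n + 1)) :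
    p.len 0 n i / 2 ≤ |p.psi 0 N i u - p.psi 0 N j v| := by
  obtain ⟨d, rfl⟩ : ∃ d, N = n + 1 + d := ⟨N - (n + 1), by omega⟩
  obtain ⟨u', hu', e1⟩ := p.psi_trunc 0 (n + 1) d i hu
  obtain ⟨v', hv', e2⟩ := p.psi_trunc 0 (n + 1) d j hv
  rw [e1, e2]
  exact p.psi_sep 0 n hu' hv' h1 h2

noncomputable def A (k n : ℕ) : ℝ := ∏ l ∈ Finset.range n, p.a (k + l)
noncomputable def B (k n : ℕ) : ℝ := ∏ l ∈ Finset.range n, p.b (k + l)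

lemma A_succ' (k n : ℕ) : p.A k (n + 1) = p.a k * p.A (k + 1) n := by
  unfold A
  rw [Finset.prod_range_succ', mul_comm]
  congr 1
  exact Finset.prod_congr rfl (fun l _ => by congr 1; ring)

lemma B_succ' (k n : ℕ) : p.B k (n + 1) = p.b k * p.B (k + 1) n := by
  unfold B
  rw [Finset.prod_range_succ', mul_comm]
  congr 1
  exact Finset.prod_congr rfl (fun l _ => by congr 1; ring)

lemma A_succ (k n : ℕ) : p.A k (n + 1) = p.A k n * p.a (k + n) := Finset.prod_range_succ _ _

lemma B_succ (k n : ℕ) : p.B k (n + 1) = p.B k n * p.b (k + n) := Finset.prod_range_succ _ _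

lemma A_pos (k n : ℕ) : 0 < p.A k n := Finset.prod_pos (fun _ _ => p.a_pos _)
lemma B_pos (k n : ℕ) : 0 < p.B k n := Finset.prod_pos (fun _ _ => p.b_pos _)

lemma A_le_pow (k n : ℕ) : p.A k n ≤ (1 / 4) ^ n := by
  induction n with
  | zero => simp [A]
  | succ n ih =>
    rw [A_succ, pow_succ]
    exact mul_le_mul ih (p.a_le _) (p.a_pos _).le (by positivity)

lemma A_anti (k : ℕ) : Antitone (p.A k) := antitone_nat_of_succ_le (fun n => by
  rw [A_succ]
  have := p.A_pos k n; have := p.a_le (k + n)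
  nlinarith)

lemma len_le (k n i : ℕ) : p.len k n i ≤ p.A k n := by
  induction n generalizing k i with
  | zero => simp [len, A]
  | succ n ih =>
    rw [A_succ']
    unfold len
    have := p.a_pos k; have := p.b_le k
    refine mul_le_mul ?_ (ih _ _) (p.len_pos _ _ _).le (p.a_pos k).le
    split_ifs <;> linarith

lemma le_len (k n i : ℕ) : p.B k n ≤ p.len k n i := by
  induction n generalizing k i with
  | zero => simp [len, B]
  | succ n ih =>
    rw [B_succ']
    unfold len
    have := p.b_pos k; have := p.b_le k
    refine mul_le_mul ?_ (ih _ _) (p.B_pos _ _).le ?_ <;> split_ifs <;> linarith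

lemma len_zero (k n i : ℕ) (hi : i % 2 ^ n = 0) : p.len k n i = p.A k n := by
  induction n generalizing k i with
  | zero => simp [len, A]
  | succ n ih =>
    obtain ⟨h1, h2⟩ := mod_half (j := 0) (by simpa using hi)
    rw [p.len_even _ _ (by simpa using h1), A_succ', ih _ _ (by simpa using h2)]

lemma len_good (k n i : ℕ) (hi : (i / 2 ^ n) % 2 = 1) : p.len k (n + 1) i ≤ p.A k n * p.b (k + n) := by
  induction n generalizing k i with
  | zero =>
    rw [p.len_odd _ _ (by simpa using hi)]
    simp [len, A]
  | succ n ih =>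
    have e : i / 2 / 2 ^ n = i / 2 ^ (n + 1) := by rw [Nat.div_div_eq_div_mul, pow_succ']
    have h := ih (k + 1) (i / 2) (by rw [e]; exact hi)
    rw [A_succ', mul_assoc, show k + (n + 1) = k + 1 + n by ring]
    have := p.a_pos k; have := p.b_le k
    unfold len
    refine mul_le_mul ?_ h (p.len_pos _ _ _).le (p.a_pos k).le
    split_ifs <;> linarith

end Par


namespace Par

variable (p : Par)

lemma psi_cont (k n i : ℕ) : Continuous (p.psi k n i) := by
  induction n generalizing k i with
  | zero => exact continuous_id
  | succ n ih =>
    have := ih (k + 1) (i / 2)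
    rcases Nat.mod_two_eq_zero_or_one i with hi | hi
    · simp only [funext fun u => p.psi_even k n u hi]; fun_prop
    · simp only [funext fun u => p.psi_odd k n u hi]; fun_prop

def K (n : ℕ) : Set ℝ := {x | ∃ i, ∃ u ∈ Icc (0 : ℝ) 1, x = p.psi 0 n i u}

def C : Set ℝ := {x | ∀ n, x ∈ p.K n}

lemma K_closed (n : ℕ) : IsClosed (p.K n) := by
  have : p.K n = ⋃ i ∈ Set.Iio (2 ^ n), p.psi 0 n i '' Icc (0 : ℝ) 1 := by
    ext x
    simp only [K, mem_ofPred_eq, mem_iUnion, mem_image, mem_Iio]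
    constructor
    · rintro ⟨i, u, hu, rfl⟩
      exact ⟨i % 2 ^ n, Nat.mod_lt _ (by positivity), u, hu, p.psi_mod _ _ _ (Nat.mod_mod _ _)⟩
    · rintro ⟨i, _, u, hu, rfl⟩
      exact ⟨i, u, hu, rfl⟩
  rw [this]
  exact (Set.finite_Iio _).isClosed_biUnion
    (fun i _ => (isCompact_Icc.image (p.psi_cont 0 n i)).isClosed)

lemma K_maps (n : ℕ) : MapsTo (p.f 0) (p.K n) (p.K n) := by
  rintro x ⟨i, u, hu, rfl⟩
  obtain ⟨v, hv, h⟩ := p.iter_psi 0 n i 1 hu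
  exact ⟨i + 1, v, hv, h⟩

lemma C_eq : p.C = ⋂ n, p.K n := by ext; simp [C]

lemma C_closed : IsClosed p.C := by
  rw [C_eq]; exact isClosed_iInter p.K_closed

lemma C_maps : MapsTo (p.f 0) p.C p.C := fun _ hx n => p.K_maps n (hx n)

lemma C_sub : p.C ⊆ Icc (0 : ℝ) 1 := by
  intro x hx
  obtain ⟨i, u, hu, h⟩ := hx 0
  rw [h]
  exact p.psi_mem _ _ _ hu

lemma psi_zero_zero (k n : ℕ) : p.psi k n 0 0 = 0 := by
  induction n generalizing k with
  | zero => rfl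
  | succ n ih => rw [p.psi_even _ _ _ rfl, Nat.zero_div, ih, mul_zero]

lemma C_zero : (0 : ℝ) ∈ p.C :=
  fun n => ⟨0, 0, ⟨le_rfl, zero_le_one⟩, (p.psi_zero_zero 0 n).symm⟩

/-- orbit description -/
lemma orbit {n : ℕ} {x : ℝ} (hx : x ∈ p.K n) :
    ∃ i, ∀ j, ∃ v ∈ Icc (0 : ℝ) 1, (p.f 0)^[j] x = p.psi 0 n (i + j) v := by
  obtain ⟨i, u, hu, rfl⟩ := hx
  exact ⟨i, fun j => p.iter_psi 0 n i j hu⟩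

lemma psi_inj (n : ℕ) {i j : ℕ} {u v : ℝ} (hu : u ∈ Icc (0 : ℝ) 1) (hv : v ∈ Icc (0 : ℝ) 1)
    (h : p.psi 0 n i u = p.psi 0 n j v) : i % 2 ^ n = j % 2 ^ n := by
  by_contra hne
  obtain ⟨m, hm, h1, h2⟩ := exists_level hne
  have := p.psi_sep' n hu hv hm h1 h2
  rw [h, sub_self, abs_zero] at this
  linarith [p.len_pos 0 m i]

lemma K_period {n q : ℕ} {x : ℝ} (hx : x ∈ p.K n) (hq : (p.f 0)^[q] x = x) : 2 ^ n ∣ q := by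
  obtain ⟨i, u, hu, rfl⟩ := hx
  obtain ⟨v, hv, h⟩ := p.iter_psi 0 n i q hu
  rw [hq] at h
  have h2 := p.psi_inj n hu hv h
  have h3 : i + 0 ≡ i + q [MOD 2 ^ n] := h2
  exact (Nat.modEq_zero_iff_dvd).1 (Nat.ModEq.add_left_cancel' i h3).symm

lemma C_infinite : p.C.Infinite := by
  have hm : ∀ j, (p.f 0)^[j] 0 ∈ p.C := fun j => p.C_maps.iterate j p.C_zero
  refine Set.infinite_of_injective_forall_mem (f := fun j => (p.f 0)^[j] 0) ?_ hm
  have key : ∀ i d, (p.f 0)^[i + d] 0 = (p.f 0)^[i] 0 → d = 0 := by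
    intro i d h
    rw [Nat.add_comm, Function.iterate_add_apply] at h
    by_contra hd
    have := Nat.le_of_dvd (by omega) (p.K_period (hm i d) h)
    exact absurd this (by simpa using Nat.lt_two_pow_self)
  intro i j h
  rcases le_total i j with hij | hij
  · obtain ⟨d, rfl⟩ := Nat.exists_eq_add_of_le hij
    have := key i d h.symm; omega
  · obtain ⟨d, rfl⟩ := Nat.exists_eq_add_of_le hij
    have := key j d h; omega

lemma C_minimal (C' : Set ℝ) (hsub : C' ⊆ p.C) (hne : C'.Nonempty) (hcl : IsClosed C')
    (hm : MapsTo (p.f 0) C' C') : C' = p.C := by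
  refine hsub.antisymm (fun y hy => ?_)
  obtain ⟨x, hx⟩ := hne
  rw [← hcl.closure_eq, Metric.mem_closure_iff]
  intro ε hε
  obtain ⟨n, hn⟩ := exists_pow_lt_of_lt_one hε (show (1 / 4 : ℝ) < 1 by norm_num)
  obtain ⟨i, h⟩ := p.orbit (hsub hx n)
  obtain ⟨j, w, hw, rfl⟩ := hy n
  obtain ⟨v, hv, e⟩ := h (j + i * (2 ^ n - 1))
  refine ⟨_, hm.iterate (j + i * (2 ^ n - 1)) hx, ?_⟩
  have e2 : p.psi 0 n (i + (j + i * (2 ^ n - 1))) v = p.psi 0 n j v := by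
    apply p.psi_mod
    obtain ⟨q, hq⟩ : ∃ q, 2 ^ n = q + 1 := ⟨2 ^ n - 1, by have := Nat.one_le_two_pow (n := n); omega⟩
    rw [show i + (j + i * (2 ^ n - 1)) = j + i * 2 ^ n by rw [hq, Nat.add_sub_cancel]; ring]
    simp
  rw [e, e2, Real.dist_eq]
  exact (p.psi_close 0 n j hw hv).trans_lt
    (((p.len_le 0 n j).trans (p.A_le_pow 0 n)).trans_lt hn)

def EvPer (x : ℝ) : Prop := ∃ j m, (p.f 0)^[j] x = p.psi 0 m 0 (p.fp m)

def Sol (x : ℝ) : Prop := ∀ n, ∃ j, ∃ u ∈ Icc (0 : ℝ) 1, (p.f 0)^[j] x = p.psi 0 n 0 u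

lemma dich {x : ℝ} (hx : x ∈ Icc (0 : ℝ) 1) : p.EvPer x ∨ p.Sol x := by
  by_cases hE : p.EvPer x
  · exact Or.inl hE
  right
  intro n
  induction n with
  | zero => exact ⟨0, x, hx, rfl⟩
  | succ n ih =>
    obtain ⟨j, u, hu, h⟩ := ih
    have hit : ∀ s, (p.f 0)^[2 ^ n * s + j] x = p.psi 0 n 0 ((p.f n)^[s] u) := by
      intro s
      rw [Function.iterate_add_apply, h, p.iter_mul_pow n s hu]
    have hmem : ∀ s, (p.f n)^[s] u ∈ Icc (0 : ℝ) 1 := by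
      intro s
      have : MapsTo (p.f n) (Icc (0 : ℝ) 1) (Icc (0 : ℝ) 1) := fun y _ => p.f_mem n y
      exact this.iterate s hu
    have ha := p.a_pos n; have hb := p.b_pos n
    rcases p.middle n u with ⟨s, hs⟩ | ⟨s, hs | hs⟩
    · exact absurd ⟨_, n, by rw [hit s, hs]⟩ hE
    · refine ⟨2 ^ n * s + j, (p.f n)^[s] u / p.a n, ⟨div_nonneg (hmem s).1 ha.le, ?_⟩, ?_⟩
      · rw [div_le_one ha]; exact hs
      · rw [hit, p.psi_succ]
        simp only [Nat.zero_div, Nat.zero_mod, if_true, Nat.zero_add]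
        congr 1
        field_simp
    · have hv : ((p.f n)^[s] u - 1 + p.b n) / p.b n ∈ Icc (0 : ℝ) 1 := by
        constructor
        · apply div_nonneg _ hb.le; linarith
        · rw [div_le_one hb]; linarith [(hmem s).2]
      have e : (p.f 0)^[2 ^ n * s + j] x
          = p.psi 0 (n + 1) (2 ^ n) (((p.f n)^[s] u - 1 + p.b n) / p.b n) := by
        rw [hit, p.psi_succ, Nat.div_self (by positivity)]
        simp only [Nat.one_mod, one_ne_zero, if_false, Nat.zero_add]
        rw [p.psi_mod 0 n (i := 2 ^ n) (j := 0) _ (by simp)]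
        congr 1
        field_simp
        ring
      obtain ⟨w, hw, e2⟩ := p.iter_psi 0 (n + 1) (2 ^ n) (2 ^ n) hv
      refine ⟨2 ^ n + (2 ^ n * s + j), w, hw, ?_⟩
      rw [Function.iterate_add_apply, e, e2]
      apply p.psi_mod
      rw [← two_mul, ← pow_succ']; simp

lemma fp_isPeriodic (m : ℕ) : Function.IsPeriodicPt (p.f 0) (2 ^ m) (p.psi 0 m 0 (p.fp m)) := by
  show (p.f 0)^[2 ^ m] _ = _
  rw [p.iter_psi_fp]
  exact p.psi_mod _ _ _ (by simp)

lemma fp_period (m : ℕ) : Function.minimalPeriod (p.f 0) (p.psi 0 m 0 (p.fp m)) = 2 ^ m := by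
  apply Nat.dvd_antisymm (p.fp_isPeriodic m).minimalPeriod_dvd
  exact p.K_period ⟨0, _, p.fp_mem m, rfl⟩ (Function.iterate_minimalPeriod)

lemma periods (w : ℝ) (hw : w ∈ Icc (0 : ℝ) 1) (h : 0 < Function.minimalPeriod (p.f 0) w) :
    ∃ n : ℕ, Function.minimalPeriod (p.f 0) w = 2 ^ n := by
  have hper : w ∈ Function.periodicPts (p.f 0) := Function.minimalPeriod_pos_iff_mem_periodicPts.1 h
  rcases p.dich hw with ⟨j, m, hj⟩ | hs
  · refine ⟨m, ?_⟩
    rw [← Function.minimalPeriod_apply_iterate hper j, hj, p.fp_period]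
  · exfalso
    obtain ⟨j, u, hu, hj⟩ := hs (Function.minimalPeriod (p.f 0) w)
    have h1 := Function.minimalPeriod_apply_iterate hper j
    have h2 := p.K_period (n := Function.minimalPeriod (p.f 0) w) ⟨0, u, hu, hj⟩
      (Function.iterate_minimalPeriod)
    rw [h1] at h2
    have := Nat.le_of_dvd h h2
    exact absurd this (by simpa using Nat.lt_two_pow_self)

lemma unique_minimal (D : Set ℝ) (hD : D ⊆ Icc (0 : ℝ) 1) (hinf : D.Infinite) (hne : D.Nonempty)
    (hcl : IsClosed D) (hm : MapsTo (p.f 0) D D)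
    (hmin : ∀ D' : Set ℝ, D' ⊆ D → D'.Nonempty → IsClosed D' → MapsTo (p.f 0) D' D' → D' = D) :
    D = p.C := by
  obtain ⟨x, hx⟩ := hne
  rcases p.dich (hD hx) with ⟨j, m, hj⟩ | hs
  · exfalso
    set z := p.psi 0 m 0 (p.fp m) with hz
    have hzD : z ∈ D := hj ▸ hm.iterate j hx
    let O : Set ℝ := (fun t => (p.f 0)^[t] z) '' Set.Iio (2 ^ m)
    have hOfin : O.Finite := (Set.finite_Iio _).image _
    have hall : ∀ t, (p.f 0)^[t] z ∈ O := by
      intro t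
      refine ⟨t % 2 ^ m, Nat.mod_lt _ (by positivity), ?_⟩
      exact (p.fp_isPeriodic m).iterate_mod_apply t
    have : O = D := by
      apply hmin
      · rintro _ ⟨t, _, rfl⟩; exact hm.iterate t hzD
      · exact ⟨_, hall 0⟩
      · exact hOfin.isClosed
      · rintro _ ⟨t, _, rfl⟩
        have := hall (t + 1)
        rwa [Function.iterate_succ_apply'] at this
    exact hinf (this ▸ hOfin)
  · refine p.C_minimal D ?_ ⟨x, hx⟩ hcl hm
    intro y hy n
    obtain ⟨j, u, hu, hj⟩ := hs n
    have : D ∩ p.K n = D := by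
      apply hmin _ inter_subset_left
      · exact ⟨_, hm.iterate j hx, 0, u, hu, hj⟩
      · exact hcl.inter (p.K_closed n)
      · exact hm.inter_inter (p.K_maps n)
    rw [← this] at hy
    exact hy.2

lemma orb_mem {x : ℝ} (hx : x ∈ Icc (0 : ℝ) 1) (j : ℕ) : (p.f 0)^[j] x ∈ Icc (0 : ℝ) 1 := by
  have : MapsTo (p.f 0) (Icc (0 : ℝ) 1) (Icc (0 : ℝ) 1) := fun y _ => p.f_mem 0 y
  exact this.iterate j hx

lemma d_le {x y : ℝ} (hx : x ∈ Icc (0 : ℝ) 1) (hy : y ∈ Icc (0 : ℝ) 1) (j : ℕ) :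
    |(p.f 0)^[j] x - (p.f 0)^[j] y| ≤ 1 := by
  have h1 := p.orb_mem hx j
  have h2 := p.orb_mem hy j
  rw [abs_le]; constructor <;> linarith [h1.1, h1.2, h2.1, h2.2]

lemma liminf_pos {d : ℕ → ℝ} {c : ℝ} (hc : 0 < c) (hd1 : ∀ n, d n ≤ 1) (N : ℕ)
    (h : ∀ n ≥ N, c ≤ d n) : liminf d atTop ≠ 0 := by
  have : c ≤ liminf d atTop := by
    apply le_liminf_of_le
    · exact Filter.IsBoundedUnder.isCoboundedUnder_ge (Filter.isBoundedUnder_of ⟨1, hd1⟩)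
    · exact eventually_atTop.2 ⟨N, h⟩
  linarith

lemma limsup_le' {d : ℕ → ℝ} {c : ℝ} (hd0 : ∀ n, 0 ≤ d n) (N : ℕ)
    (h : ∀ n ≥ N, d n ≤ c) : limsup d atTop ≤ c := by
  apply limsup_le_of_le
  · exact Filter.IsBoundedUnder.isCoboundedUnder_le (Filter.isBoundedUnder_of ⟨0, hd0⟩)
  · exact eventually_atTop.2 ⟨N, h⟩

lemma sol_orbit {x : ℝ} (hx : p.Sol x) (n : ℕ) :
    ∃ i J, ∀ j ≥ J, ∃ u ∈ Icc (0 : ℝ) 1, (p.f 0)^[j] x = p.psi 0 n (i + j) u := by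
  obtain ⟨J, u, hu, h⟩ := hx n
  refine ⟨J * (2 ^ n - 1), J, fun j hj => ?_⟩
  obtain ⟨t, rfl⟩ := Nat.exists_eq_add_of_le hj
  obtain ⟨v, hv, e⟩ := p.iter_psi 0 n 0 t hu
  refine ⟨v, hv, ?_⟩
  rw [Nat.add_comm J t, Function.iterate_add_apply, h, e]
  apply p.psi_mod
  obtain ⟨q, hq⟩ : ∃ q, 2 ^ n = q + 1 := ⟨2 ^ n - 1, by have := Nat.one_le_two_pow (n := n); omega⟩
  rw [show J * (2 ^ n - 1) + (t + J) = t + J * 2 ^ n by rw [hq, Nat.add_sub_cancel]; ring]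
  simp

lemma sol_not {x y : ℝ} (hx : x ∈ Icc (0 : ℝ) 1) (hy : y ∈ Icc (0 : ℝ) 1)
    (sx : p.Sol x) (sy : p.Sol y)
    (h1 : liminf (fun n => |(p.f 0)^[n] x - (p.f 0)^[n] y|) atTop = 0)
    (h2 : 0 < limsup (fun n => |(p.f 0)^[n] x - (p.f 0)^[n] y|) atTop) : False := by
  have key : ∀ n, limsup (fun n => |(p.f 0)^[n] x - (p.f 0)^[n] y|) atTop ≤ (1 / 4) ^ n := by
    intro n
    obtain ⟨i, J, hi⟩ := p.sol_orbit sx n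
    obtain ⟨i', J', hi'⟩ := p.sol_orbit sy n
    by_cases hne : i % 2 ^ n = i' % 2 ^ n
    · apply limsup_le' (fun _ => abs_nonneg _) (max J J')
      intro j hj
      obtain ⟨u, hu, e⟩ := hi j (le_of_max_le_left hj)
      obtain ⟨v, hv, e'⟩ := hi' j (le_of_max_le_right hj)
      rw [e, e', p.psi_mod 0 n (i := i' + j) (j := i + j) v (Nat.ModEq.add_right j hne).symm]
      exact (p.psi_close 0 n _ hu hv).trans ((p.len_le 0 n _).trans (p.A_le_pow 0 n))
    · exfalso
      obtain ⟨m, hm, e1, e2⟩ := exists_level hne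
      refine liminf_pos (c := p.B 0 m / 2) (by have := p.B_pos 0 m; positivity)
        (p.d_le hx hy) (max J J') ?_ h1
      intro j hj
      obtain ⟨u, hu, e⟩ := hi j (le_of_max_le_left hj)
      obtain ⟨v, hv, e'⟩ := hi' j (le_of_max_le_right hj)
      rw [e, e']
      have := p.psi_sep' n hu hv hm (i := i + j) (j := i' + j) (Nat.ModEq.add_right j e1)
        (fun h => e2 (Nat.ModEq.add_right_cancel' j h))
      have := p.le_len 0 m (i + j)
      linarith
  have h : Tendsto (fun n : ℕ => (1 / 4 : ℝ) ^ n) atTop (nhds 0) :=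
    (tendsto_pow_atTop_nhds_zero_of_lt_one (by norm_num) (by norm_num))
  have := ge_of_tendsto' h key
  linarith

lemma evper_not {x y : ℝ} (hx : x ∈ Icc (0 : ℝ) 1) (hy : y ∈ Icc (0 : ℝ) 1)
    (sx : p.EvPer x) (sy : p.EvPer y)
    (h1 : liminf (fun n => |(p.f 0)^[n] x - (p.f 0)^[n] y|) atTop = 0)
    (h2 : 0 < limsup (fun n => |(p.f 0)^[n] x - (p.f 0)^[n] y|) atTop) : False := by
  have hper : ∀ z, p.EvPer z → ∃ J m, ∀ j ≥ J, ∀ t, (p.f 0)^[j + 2 ^ m * t] z = (p.f 0)^[j] z := by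
    rintro z ⟨J, m, h⟩
    refine ⟨J, m, fun j hj t => ?_⟩
    obtain ⟨r, rfl⟩ := Nat.exists_eq_add_of_le hj
    rw [show J + r + 2 ^ m * t = (r + 2 ^ m * t) + J by ring, Nat.add_comm J r,
      Function.iterate_add_apply, h, Function.iterate_add_apply _ r J, h, p.iter_psi_fp, p.iter_psi_fp]
    apply p.psi_mod
    simp
  obtain ⟨J, m, hJ⟩ := hper x sx
  obtain ⟨J', m', hJ'⟩ := hper y sy
  set N := max J J'
  set q := 2 ^ m * 2 ^ m' with hq
  have hqpos : 0 < q := by positivity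
  set d := fun n => |(p.f 0)^[n] x - (p.f 0)^[n] y| with hd
  have hdper : ∀ j ≥ N, ∀ t, d (j + q * t) = d j := by
    intro j hj t
    simp only [hd]
    rw [hq, show j + 2 ^ m * 2 ^ m' * t = j + 2 ^ m * (2 ^ m' * t) by ring,
      hJ j (le_of_max_le_left hj), show j + 2 ^ m * (2 ^ m' * t) = j + 2 ^ m' * (2 ^ m * t) by ring,
      hJ' j (le_of_max_le_right hj)]
  by_cases hz : ∃ j, d j = 0
  · obtain ⟨j, hj⟩ := hz
    have : limsup d atTop ≤ 0 := by
      apply limsup_le' (fun _ => abs_nonneg _) j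
      intro n hn
      obtain ⟨t, rfl⟩ := Nat.exists_eq_add_of_le hn
      have e : (p.f 0)^[j] x = (p.f 0)^[j] y := by
        exact sub_eq_zero.1 (abs_eq_zero.1 hj)
      rw [Nat.add_comm j t, Function.iterate_add_apply, Function.iterate_add_apply, e]
      simp
    linarith
  · push Not at hz
    obtain ⟨r, _, hr⟩ := Finset.exists_min_image (Finset.range q) (fun r => d (N + r))
      ⟨0, Finset.mem_range.2 hqpos⟩
    refine liminf_pos (c := d (N + r)) (lt_of_le_of_ne (abs_nonneg _) (hz _).symm)
      (p.d_le hx hy) N ?_ h1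
    intro n hn
    obtain ⟨t, rfl⟩ := Nat.exists_eq_add_of_le hn
    have := hdper (N + t % q) (by omega) (t / q)
    rw [Nat.add_assoc, Nat.mod_add_div] at this
    refine le_trans ?_ this.ge
    exact hr _ (Finset.mem_range.2 (Nat.mod_lt _ hqpos))

lemma not_chaotic : ¬ ∃ S : Set ℝ, S ⊆ Icc (0 : ℝ) 1 ∧ ¬ S.Countable ∧
        ∀ a ∈ S, ∀ b ∈ S, a ≠ b →
          liminf (fun n => |(p.f 0)^[n] a - (p.f 0)^[n] b|) atTop = 0 ∧
          0 < limsup (fun n => |(p.f 0)^[n] a - (p.f 0)^[n] b|) atTop := by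
  rintro ⟨S, hS, hunc, h⟩
  apply hunc
  have h1 : (S ∩ {x | p.EvPer x}).Subsingleton := by
    intro x hx y hy
    by_contra hne
    obtain ⟨e1, e2⟩ := h x hx.1 y hy.1 hne
    exact p.evper_not (hS hx.1) (hS hy.1) hx.2 hy.2 e1 e2
  have h2 : (S ∩ {x | p.Sol x}).Subsingleton := by
    intro x hx y hy
    by_contra hne
    obtain ⟨e1, e2⟩ := h x hx.1 y hy.1 hne
    exact p.sol_not (hS hx.1) (hS hy.1) hx.2 hy.2 e1 e2
  refine (h1.finite.union h2.finite).countable.mono (fun x hx => ?_)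
  rcases p.dich (hS hx) with h | h
  · exact Or.inl ⟨hx, h⟩
  · exact Or.inr ⟨hx, h⟩

end Par


section DetLemmas

variable (f : ℝ → ℝ) (x : ℝ)

lemma corr_nonneg (m n : ℕ) (ε : ℝ) : 0 ≤ corrSum f x m n ε := by
  unfold corrSum; positivity

lemma corr_le (m n : ℕ) (hm : 1 ≤ m) (ε : ℝ) : corrSum f x m n ε ≤ corrSum f x 1 n ε := by
  unfold corrSum
  apply div_le_div_of_nonneg_right _ (by positivity)
  exact Nat.cast_le.2 (Finset.card_le_card (fun q hq => by
    simp only [Finset.mem_filter] at hq ⊢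
    exact ⟨hq.1, fun k hk => hq.2 k (by omega)⟩))

lemma det_nonneg (m n : ℕ) (ε : ℝ) : 0 ≤ detSum f x m n ε :=
  div_nonneg (corr_nonneg f x m n ε) (corr_nonneg f x 1 n ε)

lemma det_le_one (m n : ℕ) (hm : 1 ≤ m) (ε : ℝ) : detSum f x m n ε ≤ 1 :=
  div_le_one_of_le₀ (corr_le f x m n hm ε) (corr_nonneg f x 1 n ε)

lemma corr_pos (n : ℕ) (hn : 1 ≤ n) {ε : ℝ} (hε : 0 ≤ ε) : 0 < corrSum f x 1 n ε := by
  unfold corrSum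
  apply div_pos
  · rw [Nat.cast_pos, Finset.card_pos]
    refine ⟨(0, 0), ?_⟩
    simp only [Finset.mem_filter, Finset.mem_product, Finset.mem_range]
    refine ⟨⟨by omega, by omega⟩, fun k _ => by simpa using hε⟩
  · positivity

lemma upper_nonneg (m : ℕ) (hm : 1 ≤ m) (ε : ℝ) : 0 ≤ upperDet f x m ε := by
  exact le_limsup_of_frequently_le (Eventually.of_forall fun n => det_nonneg f x m n ε).frequently <|
    isBoundedUnder_of ⟨1, fun n => det_le_one f x m n hm ε⟩

lemma lower_nonneg (m : ℕ) (hm : 1 ≤ m) (ε : ℝ) : 0 ≤ lowerDet f x m ε := by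
  apply le_liminf_of_le _ (Eventually.of_forall fun n => det_nonneg f x m n ε)
  exact (isBoundedUnder_of ⟨1, fun n => det_le_one f x m n hm ε⟩).isCoboundedUnder_ge

lemma lower_le_one (m : ℕ) (hm : 1 ≤ m) (ε : ℝ) : lowerDet f x m ε ≤ 1 := by
  exact liminf_le_of_frequently_le (Eventually.of_forall fun n => det_le_one f x m n hm ε).frequently <|
    isBoundedUnder_of ⟨0, fun n => det_nonneg f x m n ε⟩

lemma lowerInf_nonneg (ε : ℝ) : 0 ≤ lowerDetInf f x ε :=
  le_ciInf fun m => lower_nonneg f x (m + 1) (by omega) ε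

lemma upperInf_nonneg (ε : ℝ) : 0 ≤ upperDetInf f x ε :=
  le_ciInf fun m => upper_nonneg f x (m + 1) (by omega) ε

lemma lowerInf_le_one (ε : ℝ) : lowerDetInf f x ε ≤ 1 :=
  (ciInf_le ⟨0, by rintro _ ⟨m, rfl⟩; exact lower_nonneg f x (m + 1) (by omega) ε⟩ 0).trans
    (lower_le_one f x 1 le_rfl ε)

lemma upperInf_le (m : ℕ) (hm : 1 ≤ m) (ε : ℝ) : upperDetInf f x ε ≤ upperDet f x m ε := by
  have := ciInf_le (f := fun m : ℕ => upperDet f x (m + 1) ε)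
    ⟨0, by rintro _ ⟨m, rfl⟩; exact upper_nonneg f x (m + 1) (by omega) ε⟩ (m - 1)
  rwa [Nat.sub_add_cancel hm] at this

lemma det1 {ε : ℝ} (hε : 0 ≤ ε)
    (h : ∀ i j, dist (f^[i] x) (f^[j] x) ≤ ε → ∀ k, dist (f^[i + k] x) (f^[j + k] x) ≤ ε) :
    lowerDetInf f x ε = 1 ∧ upperDetInf f x ε = 1 := by
  have key : ∀ m n, 1 ≤ n → detSum f x (m + 1) n ε = 1 := by
    intro m n hn
    have hle : corrSum f x 1 n ε ≤ corrSum f x (m + 1) n ε := by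
      unfold corrSum
      apply div_le_div_of_nonneg_right _ (by positivity)
      exact Nat.cast_le.2 (Finset.card_le_card (fun q hq => by
        simp only [Finset.mem_filter] at hq ⊢
        exact ⟨hq.1, fun k _ => h _ _ (by simpa using hq.2 0 (by omega)) k⟩))
    have := le_antisymm (corr_le f x (m + 1) n (by omega) ε) hle
    unfold detSum
    rw [this, div_self (corr_pos f x n hn hε).ne']
  have ht : ∀ m, Tendsto (fun n => detSum f x (m + 1) n ε) atTop (nhds 1) := fun m =>
    tendsto_const_nhds.congr' (eventually_atTop.2 ⟨1, fun n hn => (key m n hn).symm⟩)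
  constructor
  · unfold lowerDetInf lowerDet
    simp only [fun m => (ht m).liminf_eq, ciInf_const]
  · unfold upperDetInf upperDet
    simp only [fun m => (ht m).limsup_eq, ciInf_const]

lemma count_upper {ε : ℝ} {m n Q : ℕ} (hQ : 0 < Q)
    (h1 : ∀ i j, (∀ l < m, dist (f^[i + l] x) (f^[j + l] x) ≤ ε) → i % Q = j % Q) :
    ((Finset.range n ×ˢ Finset.range n).filter
      (fun p => ∀ k < m, dist (f^[p.1 + k] x) (f^[p.2 + k] x) ≤ ε)).card ≤ n * (n / Q + 1) := by
  have : (Finset.range n ×ˢ Finset.range (n / Q + 1)).card = n * (n / Q + 1) := by simp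
  rw [← this]
  apply Finset.card_le_card_of_injOn (fun q => (q.1, q.2 / Q))
  · rintro ⟨i, j⟩ hq
    simp only [Finset.coe_filter, Finset.mem_product, Finset.mem_range, mem_ofPred_eq] at hq
    simp only [Finset.coe_product, Finset.coe_range, mem_prod, mem_Iio]
    exact ⟨hq.1.1, Nat.lt_succ_of_le (Nat.div_le_div_right hq.1.2.le)⟩
  · rintro ⟨i, j⟩ hq ⟨i', j'⟩ hq' e
    simp only [Finset.coe_filter, Finset.mem_product, Finset.mem_range, mem_ofPred_eq] at hq hq'
    simp only [Prod.mk.injEq] at e ⊢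
    have e1 := h1 _ _ hq.2
    have e2 := h1 _ _ hq'.2
    refine ⟨e.1, ?_⟩
    rw [← Nat.div_add_mod j Q, ← Nat.div_add_mod j' Q, e.2, ← e1, ← e2, e.1]

lemma count_lower {ε : ℝ} {n s i0 : ℕ}
    (h2 : ∀ i j, i % 2 ^ (s + 1) = j % 2 ^ (s + 1) → ((i0 + i) / 2 ^ s) % 2 = 1 →
      dist (f^[i] x) (f^[j] x) ≤ ε) :
    (n / 2 ^ (s + 1)) * (n / 2 ^ (s + 1)) * 2 ^ s ≤ ((Finset.range n ×ˢ Finset.range n).filter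
      (fun p => ∀ k < 1, dist (f^[p.1 + k] x) (f^[p.2 + k] x) ≤ ε)).card := by
  set R := 2 ^ (s + 1) with hR
  have hRs : R = 2 ^ s * 2 := pow_succ _ _
  have hRpos : 0 < R := by positivity
  set q := n / R with hq
  have hqn : q * R ≤ n := Nat.div_mul_le_self n R
  set c := R - i0 % R with hc
  have hic : (i0 + c) % R = 0 := by
    have h3 := Nat.mod_lt i0 hRpos
    have h4 : i0 + c = R * (i0 / R + 1) := by
      have := Nat.div_add_mod i0 R
      rw [mul_add, mul_one]; omega
    rw [h4]; simp
  let ρ : ℕ → ℕ := fun γ => (2 ^ s + γ + c) % R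
  have hρlt : ∀ γ, ρ γ < R := fun γ => Nat.mod_lt _ hRpos
  have hgood : ∀ α γ, γ < 2 ^ s → ((i0 + (α * R + ρ γ)) / 2 ^ s) % 2 = 1 := by
    intro α γ hγ
    rw [← Nat.mod_mul_right_div_self, ← hRs]
    have : (i0 + (α * R + ρ γ)) % R = 2 ^ s + γ := by
      have h5 : i0 + (α * R + ρ γ) ≡ i0 + (0 + (2 ^ s + γ + c)) [MOD R] := by
        refine Nat.ModEq.add_left _ (Nat.ModEq.add ?_ (Nat.mod_modEq _ _))
        exact (Nat.modEq_zero_iff_dvd).2 (dvd_mul_left _ _)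
      have h6 : i0 + (0 + (2 ^ s + γ + c)) ≡ 2 ^ s + γ + 0 [MOD R] := by
        rw [show i0 + (0 + (2 ^ s + γ + c)) = 2 ^ s + γ + (i0 + c) by ring]
        exact Nat.ModEq.add_left _ (show (i0 + c) % R = 0 % R by rw [hic, Nat.zero_mod])
      have h7 := h5.trans h6
      rw [Nat.add_zero] at h7
      exact Eq.trans (show _ % R = _ % R from h7) (Nat.mod_eq_of_lt (by omega))
    rw [this, Nat.add_div_left _ (by positivity), Nat.div_eq_of_lt hγ]
  have hlt : ∀ α γ, α < q → α * R + ρ γ < n := by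
    intro α γ hα
    have := hρlt γ
    have : (α + 1) * R ≤ q * R := Nat.mul_le_mul_right _ hα
    rw [add_mul, one_mul] at this
    omega
  have hcard : (Finset.range q ×ˢ Finset.range q ×ˢ Finset.range (2 ^ s)).card = q * q * 2 ^ s := by
    simp [mul_assoc]
  rw [← hcard]
  apply Finset.card_le_card_of_injOn (fun z => (z.1 * R + ρ z.2.2, z.2.1 * R + ρ z.2.2))
  · rintro ⟨α, β, γ⟩ hz
    simp only [Finset.coe_product, Finset.coe_range, mem_prod, mem_Iio] at hz
    simp only [Finset.coe_filter, Finset.mem_product, Finset.mem_range, mem_ofPred_eq]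
    refine ⟨⟨hlt _ _ hz.1, hlt _ _ hz.2.1⟩, ?_⟩
    intro k hk
    obtain rfl : k = 0 := by omega
    exact h2 _ _ (by simp) (hgood _ _ hz.2.2)
  · rintro ⟨α, β, γ⟩ hz ⟨α', β', γ'⟩ hz' e
    simp only [Finset.coe_product, Finset.coe_range, mem_prod, mem_Iio] at hz hz'
    simp only [Prod.mk.injEq] at e ⊢
    have hmod : ∀ α γ, (α * R + ρ γ) % R = ρ γ := fun α γ => by
      rw [Nat.mul_add_mod_self_right, Nat.mod_eq_of_lt (hρlt γ)]
    have e1 : ρ γ = ρ γ' := by rw [← hmod α γ, ← hmod α' γ', e.1]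
    have e2 : γ = γ' := by
      have h3 : 2 ^ s + γ + c ≡ 2 ^ s + γ' + c [MOD R] := e1
      have h4 : (2 ^ s + γ) % R = (2 ^ s + γ') % R := Nat.ModEq.add_right_cancel' c h3
      rw [Nat.mod_eq_of_lt (by omega), Nat.mod_eq_of_lt (by omega)] at h4
      omega
    rw [e1] at e
    refine ⟨Nat.eq_of_mul_eq_mul_right hRpos (by omega), Nat.eq_of_mul_eq_mul_right hRpos (by omega), e2⟩

lemma det2 {ε : ℝ} {s k i0 m : ℕ}
    (h1 : ∀ i j, (∀ l < m, dist (f^[i + l] x) (f^[j + l] x) ≤ ε) →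
      i % 2 ^ (s + 1 + k) = j % 2 ^ (s + 1 + k))
    (h2 : ∀ i j, i % 2 ^ (s + 1) = j % 2 ^ (s + 1) → ((i0 + i) / 2 ^ s) % 2 = 1 →
      dist (f^[i] x) (f^[j] x) ≤ ε) :
    upperDet f x m ε ≤ (2 : ℝ) ^ ((1 : ℤ) - (k : ℤ)) := by
  set Q : ℕ := 2 ^ (s + 1 + k) with hQ
  set R : ℕ := 2 ^ (s + 1) with hR
  have hQpos : (0 : ℝ) < Q := by positivity
  have hRpos : (0 : ℝ) < R := by positivity
  let g : ℝ → ℝ := fun y => (1 / Q + y) / ((1 / R - y) ^ 2 * 2 ^ s)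
  have hg : Tendsto g (nhds 0) (nhds (g 0)) := by
    apply ContinuousAt.tendsto
    apply ContinuousAt.div
    · fun_prop
    · fun_prop
    · simp only [sub_zero]; positivity
  have hg0 : g 0 = (2 : ℝ) ^ ((1 : ℤ) - (k : ℤ)) := by
    rw [zpow_sub₀ two_ne_zero, zpow_natCast, zpow_one]
    simp only [g, hQ, hR, add_zero, sub_zero]
    push_cast
    field_simp
    ring
  have ht : Tendsto (fun n : ℕ => g (1 / (n : ℝ))) atTop (nhds ((2 : ℝ) ^ ((1 : ℤ) - (k : ℤ)))) := by
    rw [← hg0]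
    exact hg.comp tendsto_one_div_atTop_nhds_zero_nat
  unfold upperDet
  rw [← ht.limsup_eq]
  apply limsup_le_limsup
  · filter_upwards [eventually_gt_atTop R] with n hn
    have hnpos : (0 : ℝ) < n := by
      have : 0 < n := lt_of_le_of_lt (Nat.zero_le _) hn
      exact_mod_cast this
    have hnR : (R : ℝ) < n := by exact_mod_cast hn
    have cu := count_upper f x (n := n) (by positivity) h1
    have cl := count_lower f x (n := n) h2
    unfold detSum corrSum
    rw [div_div_div_cancel_right₀ (by positivity)]
    have hu : (((Finset.range n ×ˢ Finset.range n).filter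
      (fun p => ∀ k < m, dist (f^[p.1 + k] x) (f^[p.2 + k] x) ≤ ε)).card : ℝ) ≤ n * (n / Q + 1) := by
      refine (Nat.cast_le.2 cu).trans ?_
      push_cast
      gcongr
      exact Nat.cast_div_le
    have hl : ((n : ℝ) / R - 1) ^ 2 * 2 ^ s ≤ (((Finset.range n ×ˢ Finset.range n).filter
      (fun p => ∀ k < 1, dist (f^[p.1 + k] x) (f^[p.2 + k] x) ≤ ε)).card : ℝ) := by
      refine le_trans ?_ (Nat.cast_le.2 cl)
      push_cast
      rw [← sq]
      have h3 : (n : ℝ) / R - 1 ≤ ((n / R : ℕ) : ℝ) := by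
        have := Nat.lt_floor_add_one ((n : ℝ) / R)
        rw [Nat.floor_div_eq_div] at this
        linarith
      have h4 : 0 ≤ (n : ℝ) / R - 1 := by
        rw [sub_nonneg, one_le_div hRpos]; exact hnR.le
      gcongr
    have hpos : 0 < ((n : ℝ) / R - 1) ^ 2 * 2 ^ s := by
      have h4 : 0 < (n : ℝ) / R - 1 := by
        rw [sub_pos, one_lt_div hRpos]; exact hnR
      positivity
    have hfin := div_le_div₀ (by positivity) hu hpos hl
    refine le_trans (le_of_eq (by congr!)) (hfin.trans (le_of_eq ?_))
    simp only [g]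
    have e1 : (n : ℝ) * (n / Q + 1) = n ^ 2 * (1 / Q + 1 / n) := by field_simp
    have e2 : ((n : ℝ) / R - 1) ^ 2 * 2 ^ s = n ^ 2 * ((1 / R - 1 / n) ^ 2 * 2 ^ s) := by
      field_simp
    rw [e1, e2, mul_div_mul_left _ _ (by positivity)]
  · exact (isBoundedUnder_of ⟨0, fun n => det_nonneg f x m n ε⟩).isCoboundedUnder_le
  · exact ht.isBoundedUnder_le

end DetLemmas


lemma upper_le_one (f : ℝ → ℝ) (x : ℝ) (m : ℕ) (hm : 1 ≤ m) (ε : ℝ) : upperDet f x m ε ≤ 1 := by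
  apply limsup_le_of_le _ (Eventually.of_forall fun n => det_le_one f x m n hm ε)
  exact (isBoundedUnder_of ⟨0, fun n => det_nonneg f x m n ε⟩).isCoboundedUnder_le

noncomputable def aux (n : ℕ) (β : ℝ) : ℝ := if ∃ j, n = 2 ^ j then β / 4 else 1 / 4

noncomputable def BB : ℕ → ℝ
  | 0 => 1
  | n + 1 => BB n * (aux n (BB n) * (1 / 4) ^ (n + 1))

lemma aux_pos (n : ℕ) {β : ℝ} (h : 0 < β) : 0 < aux n β := by
  unfold aux; split_ifs <;> linarith

lemma aux_le (n : ℕ) {β : ℝ} (h : β ≤ 1) : aux n β ≤ 1 / 4 := by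
  unfold aux; split_ifs <;> linarith

lemma quarter_pow_le (n : ℕ) : (1 / 4 : ℝ) ^ n ≤ 1 := pow_le_one₀ (by norm_num) (by norm_num)

lemma BB_mem (n : ℕ) : 0 < BB n ∧ BB n ≤ 1 := by
  induction n with
  | zero => exact ⟨one_pos, le_rfl⟩
  | succ n ih =>
    have h1 := aux_pos n ih.1
    have h2 := aux_le n ih.2
    have h3 := quarter_pow_le (n + 1)
    have h4 : (0 : ℝ) < (1 / 4) ^ (n + 1) := by positivity
    have h5 := ih.1
    refine ⟨by unfold BB; positivity, ?_⟩
    unfold BB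
    have : aux n (BB n) * (1 / 4) ^ (n + 1) ≤ 1 := mul_le_one₀ (by linarith) h4.le h3
    exact mul_le_one₀ ih.2 (by positivity) this

noncomputable def pp : Par where
  a n := aux n (BB n)
  b n := aux n (BB n) * (1 / 4) ^ (n + 1)
  a_pos n := aux_pos n (BB_mem n).1
  a_le n := aux_le n (BB_mem n).2
  b_pos n := mul_pos (aux_pos n (BB_mem n).1) (by positivity)
  b_le n := mul_le_of_le_one_right (aux_pos n (BB_mem n).1).le (quarter_pow_le _)

lemma pp_b (n : ℕ) : pp.b n = pp.a n * (1 / 4) ^ (n + 1) := rfl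

lemma pp_B (n : ℕ) : pp.B 0 n = BB n := by
  induction n with
  | zero => simp [Par.B, BB]
  | succ n ih => rw [Par.B_succ, ih, Nat.zero_add]; rfl

lemma BB_succ (n : ℕ) : BB (n + 1) = BB n * pp.b n := rfl

lemma BB_anti : StrictAnti BB := strictAnti_nat_of_succ_lt fun n => by
  rw [BB_succ]
  have := (BB_mem n).1; have := pp.b_le' n
  nlinarith

lemma BB_le_pow (n : ℕ) : BB n ≤ (1 / 4) ^ n := by
  induction n with
  | zero => simp [BB]
  | succ n ih =>
    rw [BB_succ, pow_succ]
    exact mul_le_mul ih (pp.b_le' n) (pp.b_pos n).le (by positivity)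

lemma pp_a_special (k : ℕ) : pp.a (2 ^ k) = BB (2 ^ k) / 4 := by
  show aux _ _ = _
  unfold aux
  rw [if_pos ⟨k, rfl⟩]

lemma pp_a_other (k d : ℕ) (hd : d < k) : pp.a (2 ^ (k + 1) + 1 + d) = 1 / 4 := by
  show aux _ _ = _
  unfold aux
  rw [if_neg]
  rintro ⟨j, hj⟩
  have h1 : 2 ^ (k + 1) < 2 ^ j := by omega
  have h2 : 2 ^ j < 2 ^ (k + 2) := by
    have : k < 2 ^ k := Nat.lt_two_pow_self
    rw [pow_succ, pow_succ] at *; omega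
  rw [Nat.pow_lt_pow_iff_right (by norm_num)] at h1 h2
  omega

noncomputable def eps (k : ℕ) : ℝ := BB (2 ^ k) / 4

def sk (k : ℕ) : ℕ := 2 ^ (k + 1) + 1

noncomputable def eps' (k : ℕ) : ℝ := pp.A 0 (sk k) * pp.b (sk k)

lemma eps_pos (k : ℕ) : 0 < eps k := by
  have := (BB_mem (2 ^ k)).1
  unfold eps; positivity

lemma eps'_pos (k : ℕ) : 0 < eps' k := mul_pos (pp.A_pos _ _) (pp.b_pos _)

lemma eps_anti : StrictAnti eps := by
  intro i j h
  have := BB_anti (Nat.pow_lt_pow_right (show 1 < 2 by norm_num) h)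
  unfold eps
  linarith

lemma quarter_tendsto : Tendsto (fun n : ℕ => (1 / 4 : ℝ) ^ n) atTop (nhds 0) :=
  tendsto_pow_atTop_nhds_zero_of_lt_one (by norm_num) (by norm_num)

lemma eps_tendsto : Tendsto eps atTop (nhds 0) := by
  refine squeeze_zero (fun k => (eps_pos k).le) (fun k => ?_) quarter_tendsto
  have h1 := BB_anti.antitone (show k ≤ 2 ^ k from Nat.lt_two_pow_self.le)
  have h2 := BB_le_pow k
  have := (BB_mem (2 ^ k)).1
  unfold eps
  linarith

lemma k_le_sk (k : ℕ) : k ≤ sk k := by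
  have : k + 1 < 2 ^ (k + 1) := Nat.lt_two_pow_self
  unfold sk; omega

lemma eps'_tendsto : Tendsto eps' atTop (nhds 0) := by
  refine squeeze_zero (fun k => (eps'_pos k).le) (fun k => ?_) quarter_tendsto
  have h1 := pp.A_anti 0 (k_le_sk k)
  have h2 := pp.A_le_pow 0 k
  have h3 := pp.A_pos 0 (sk k)
  have h4 := pp.b_le' (sk k)
  unfold eps'
  nlinarith

lemma eps'_anti : StrictAnti eps' := strictAnti_nat_of_succ_lt fun k => by
  have h0 : sk (k + 1) = 2 ^ (k + 2) + 1 := rfl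
  have h1 := pp.A_pos 0 (sk (k + 1))
  have h2 := pp.b_le' (sk (k + 1))
  have h3 : pp.A 0 (sk (k + 1)) = pp.A 0 (2 ^ (k + 2)) * (BB (2 ^ (k + 2)) / 4) := by
    rw [h0, Par.A_succ, Nat.zero_add, pp_a_special]
  have hlt : sk k + 1 ≤ 2 ^ (k + 2) := by
    have : 1 ≤ 2 ^ k := Nat.one_le_two_pow
    unfold sk; rw [pow_succ, pow_succ, pow_succ] at *; omega
  have h4 : pp.A 0 (2 ^ (k + 2)) ≤ pp.A 0 (sk k) := pp.A_anti 0 (by omega)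
  have h5 : BB (2 ^ (k + 2)) ≤ pp.b (sk k) := by
    refine (BB_anti.antitone hlt).trans ?_
    rw [BB_succ]
    exact mul_le_of_le_one_left (pp.b_pos _).le (BB_mem _).2
  have h6 := (BB_mem (2 ^ (k + 2))).1
  have h7 : pp.A 0 (2 ^ (k + 2)) * BB (2 ^ (k + 2)) ≤ pp.A 0 (sk k) * pp.b (sk k) :=
    mul_le_mul h4 h5 h6.le (pp.A_pos _ _).le
  unfold eps'
  nlinarith

lemma A_block (k d : ℕ) (hd : d ≤ k) : pp.A 0 (sk k + d) = pp.A 0 (sk k) * (1 / 4) ^ d := by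
  induction d with
  | zero => simp
  | succ d ih =>
    rw [← Nat.add_assoc, Par.A_succ, ih (by omega), Nat.zero_add, sk, pp_a_other k d (by omega), pow_succ]
    ring

lemma eps'_lt (k : ℕ) : eps' k < pp.A 0 (sk k + k) / 2 := by
  rw [A_block k k le_rfl]
  unfold eps'
  rw [pp_b, mul_div_assoc]
  apply mul_lt_mul_of_pos_left _ (pp.A_pos _ _)
  have h1 := pp.a_le (sk k)
  have h2 : (1 / 4 : ℝ) ^ (sk k + 1) ≤ (1 / 4) ^ k :=
    pow_le_pow_of_le_one (by norm_num) (by norm_num) (by have := k_le_sk k; omega)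
  have h3 : (0 : ℝ) < (1 / 4) ^ k := by positivity
  have h4 : (0 : ℝ) < (1 / 4) ^ (sk k + 1) := by positivity
  nlinarith

lemma pp_det1 {x : ℝ} (hx : x ∈ pp.C) (k : ℕ) :
    lowerDetInf (pp.f 0) x (eps k) = 1 ∧ upperDetInf (pp.f 0) x (eps k) = 1 := by
  apply det1 _ _ (eps_pos k).le
  obtain ⟨i0, ho⟩ := pp.orbit (hx (2 ^ k + 1))
  intro i j h t
  have hmod : (i0 + i) % 2 ^ (2 ^ k + 1) = (i0 + j) % 2 ^ (2 ^ k + 1) := by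
    by_contra hne
    obtain ⟨m, hm, h1, h2⟩ := Par.exists_level hne
    obtain ⟨u, hu, e⟩ := ho i
    obtain ⟨v, hv, e'⟩ := ho j
    rw [e, e', Real.dist_eq] at h
    have h3 := pp.psi_sep' _ hu hv hm h1 h2
    have h4 := pp.le_len 0 m (i0 + i)
    rw [pp_B] at h4
    have h5 := BB_anti.antitone (show m ≤ 2 ^ k by omega)
    have h6 := (BB_mem (2 ^ k)).1
    unfold eps at h
    linarith
  obtain ⟨u, hu, e⟩ := ho (i + t)
  obtain ⟨v, hv, e'⟩ := ho (j + t)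
  have hmod' : (i0 + (j + t)) % 2 ^ (2 ^ k + 1) = (i0 + (i + t)) % 2 ^ (2 ^ k + 1) := by
    rw [← Nat.add_assoc, ← Nat.add_assoc]
    exact (Nat.ModEq.add_right t hmod).symm
  rw [e, e', Real.dist_eq, pp.psi_mod 0 _ v hmod']
  refine (pp.psi_close 0 _ _ hu hv).trans ((pp.len_le 0 _ _).trans ?_)
  rw [Par.A_succ, Nat.zero_add, pp_a_special]
  exact mul_le_of_le_one_left (eps_pos k).le ((pp.A_le_pow 0 _).trans (quarter_pow_le _))

lemma pp_det2 {x : ℝ} (hx : x ∈ pp.C) (k : ℕ) :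
    upperDetInf (pp.f 0) x (eps' k) ≤ (2 : ℝ) ^ ((1 : ℤ) - (k : ℤ)) := by
  set N := sk k + 1 + k with hN
  obtain ⟨i0, ho⟩ := pp.orbit (hx N)
  refine (upperInf_le _ _ (2 ^ N) Nat.one_le_two_pow _).trans ?_
  apply det2 (s := sk k) (k := k) (i0 := i0)
  · intro i j h
    by_contra hne
    have hne' : (i0 + i) % 2 ^ N ≠ (i0 + j) % 2 ^ N :=
      fun h' => hne (Nat.ModEq.add_left_cancel' i0 h')
    obtain ⟨m, hm, h1, h2⟩ := Par.exists_level hne'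
    have hpos : 0 < 2 ^ N := by positivity
    obtain ⟨l, hl, hl0⟩ : ∃ l < 2 ^ N, (i0 + i + l) % 2 ^ N = 0 := by
      have h3 := Nat.mod_lt (i0 + i) hpos
      have h4 := Nat.div_add_mod (i0 + i) (2 ^ N)
      by_cases h0 : (i0 + i) % 2 ^ N = 0
      · exact ⟨0, hpos, h0⟩
      · refine ⟨2 ^ N - (i0 + i) % 2 ^ N, by omega, ?_⟩
        have : i0 + i + (2 ^ N - (i0 + i) % 2 ^ N) = 2 ^ N * ((i0 + i) / 2 ^ N + 1) := by
          rw [mul_add, mul_one]; omega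
        rw [this]; simp
    have h3 := h l hl
    obtain ⟨u, hu, e⟩ := ho (i + l)
    obtain ⟨v, hv, e'⟩ := ho (j + l)
    rw [e, e', Real.dist_eq, ← Nat.add_assoc, ← Nat.add_assoc] at h3
    have h4 := pp.psi_sep' N hu hv hm (i := i0 + i + l) (j := i0 + j + l) (Nat.ModEq.add_right l h1)
        (fun h => h2 (Nat.ModEq.add_right_cancel' l h))
    have hl1 : (i0 + i + l) % 2 ^ m = 0 :=
      Nat.mod_eq_zero_of_dvd ((pow_dvd_pow 2 hm.le).trans (Nat.dvd_of_mod_eq_zero hl0))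
    rw [pp.len_zero 0 m _ hl1] at h4
    have h5 := pp.A_anti 0 (show m ≤ sk k + k by omega)
    have h6 := eps'_lt k
    linarith
  · intro i j hij hgood
    obtain ⟨u, hu, e⟩ := ho i
    obtain ⟨v, hv, e'⟩ := ho j
    obtain ⟨u', hu', e2⟩ := pp.psi_trunc 0 (sk k + 1) k (i0 + i) hu
    obtain ⟨v', hv', e2'⟩ := pp.psi_trunc 0 (sk k + 1) k (i0 + j) hv
    rw [e, e', hN, e2, e2', Real.dist_eq,
      pp.psi_mod 0 (sk k + 1) (i := i0 + j) (j := i0 + i) v' (Nat.ModEq.add_left i0 hij).symm]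
    refine (pp.psi_close 0 _ _ hu' hv').trans ?_
    have := pp.len_good 0 (sk k) (i0 + i) hgood
    rwa [Nat.zero_add] at this

lemma pp_limsup {x : ℝ} (hx : x ∈ pp.C) :
    limsup (fun e => lowerDetInf (pp.f 0) x e) (nhdsWithin (0 : ℝ) (Set.Ioi 0)) = 1 := by
  have ht : Tendsto eps atTop (nhdsWithin (0 : ℝ) (Set.Ioi 0)) :=
    tendsto_nhdsWithin_iff.2 ⟨eps_tendsto, Eventually.of_forall eps_pos⟩
  apply le_antisymm
  · apply limsup_le_of_le _ (Eventually.of_forall fun e => lowerInf_le_one _ x e)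
    exact (isBoundedUnder_of ⟨0, fun e => lowerInf_nonneg _ x e⟩).isCoboundedUnder_le
  · refine le_limsup_of_frequently_le ?_ ?_
    · exact ht.frequently (Eventually.of_forall fun k => (pp_det1 hx k).1.ge).frequently
    · exact isBoundedUnder_of ⟨1, fun e => lowerInf_le_one _ x e⟩

lemma pp_liminf {x : ℝ} (hx : x ∈ pp.C) :
    liminf (fun e => upperDetInf (pp.f 0) x e) (nhdsWithin (0 : ℝ) (Set.Ioi 0)) = 0 := by
  have ht : Tendsto eps' atTop (nhdsWithin (0 : ℝ) (Set.Ioi 0)) :=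
    tendsto_nhdsWithin_iff.2 ⟨eps'_tendsto, Eventually.of_forall eps'_pos⟩
  apply le_antisymm
  · have key : ∀ k : ℕ, liminf (fun e => upperDetInf (pp.f 0) x e) (nhdsWithin (0 : ℝ) (Set.Ioi 0))
        ≤ 2 * (1 / 2) ^ k := by
      intro k
      refine liminf_le_of_frequently_le ?_ ?_
      · apply ht.frequently (Eventually.frequently _)
        filter_upwards [eventually_ge_atTop k] with n hn
        refine (pp_det2 hx n).trans ?_
        rw [zpow_sub₀ two_ne_zero, zpow_natCast, zpow_one, div_eq_mul_one_div, ← one_div_pow]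
        have : (1 / 2 : ℝ) ^ n ≤ (1 / 2) ^ k := pow_le_pow_of_le_one (by norm_num) (by norm_num) hn
        linarith
      · exact isBoundedUnder_of ⟨0, fun e => upperInf_nonneg _ x e⟩
    have h : Tendsto (fun k : ℕ => 2 * (1 / 2 : ℝ) ^ k) atTop (nhds (2 * 0)) :=
      (tendsto_pow_atTop_nhds_zero_of_lt_one (by norm_num) (by norm_num)).const_mul 2
    rw [mul_zero] at h
    exact ge_of_tendsto' h key
  · apply le_liminf_of_le _ (Eventually.of_forall fun e => upperInf_nonneg _ x e)
    exact (isBoundedUnder_of ⟨1, fun e => (upperInf_le _ x 1 le_rfl e).trans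
      (upper_le_one _ x 1 le_rfl e)⟩).isCoboundedUnder_ge


/-- there is a Li-Yorke non-chaotic interval map of type `2^∞`
with a unique infinite minimal set `C` and sequences `(ε_k)`, `(ε'_k)`
decreasing to `0` such that for every `x ∈ C`: `DET_∞(x,ε_k) = 1` (both the
lower and upper `m → ∞` determinisms equal `1`) and `DET̄_∞(x,ε'_k) ≤ 2^{1−k}`;
consequently `limsup_{ε→0} DET̲_∞(x,ε) = 1` and `liminf_{ε→0} DET̄_∞(x,ε) = 0`. -/
theorem stmt_19 :
    ∃ (f : ℝ → ℝ) (C : Set ℝ) (ε ε' : ℕ → ℝ),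
      Continuous f ∧ MapsTo f (Icc (0 : ℝ) 1) (Icc (0 : ℝ) 1) ∧
      -- f is Li-Yorke non-chaotic: no uncountable scrambled set
      (¬ ∃ S : Set ℝ, S ⊆ Icc (0 : ℝ) 1 ∧ ¬ S.Countable ∧
        ∀ a ∈ S, ∀ b ∈ S, a ≠ b →
          liminf (fun n => |f^[n] a - f^[n] b|) atTop = 0 ∧
          0 < limsup (fun n => |f^[n] a - f^[n] b|) atTop) ∧
      -- f is of type 2^∞: the periods of periodic points are exactly the powers of 2
      (∀ n : ℕ, ∃ w ∈ Icc (0 : ℝ) 1, Function.minimalPeriod f w = 2 ^ n) ∧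
      (∀ w ∈ Icc (0 : ℝ) 1, 0 < Function.minimalPeriod f w →
        ∃ n : ℕ, Function.minimalPeriod f w = 2 ^ n) ∧
      -- C is the unique infinite minimal set
      C ⊆ Icc (0 : ℝ) 1 ∧ C.Infinite ∧ C.Nonempty ∧ IsClosed C ∧ MapsTo f C C ∧
      (∀ C' : Set ℝ, C' ⊆ C → C'.Nonempty → IsClosed C' → MapsTo f C' C' → C' = C) ∧
      (∀ D : Set ℝ, D ⊆ Icc (0 : ℝ) 1 → D.Infinite → D.Nonempty → IsClosed D →
        MapsTo f D D →
        (∀ D' : Set ℝ, D' ⊆ D → D'.Nonempty → IsClosed D' → MapsTo f D' D' → D' = D) →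
        D = C) ∧
      -- the sequences decrease to zero
      StrictAnti ε ∧ (∀ k, 0 < ε k) ∧ Tendsto ε atTop (nhds 0) ∧
      StrictAnti ε' ∧ (∀ k, 0 < ε' k) ∧ Tendsto ε' atTop (nhds 0) ∧
      -- the determinism conclusions
      (∀ x ∈ C,
        (∀ k : ℕ, lowerDetInf f x (ε k) = 1 ∧ upperDetInf f x (ε k) = 1) ∧
        (∀ k : ℕ, upperDetInf f x (ε' k) ≤ (2 : ℝ) ^ ((1 : ℤ) - (k : ℤ))) ∧
        limsup (fun e => lowerDetInf f x e) (nhdsWithin (0 : ℝ) (Set.Ioi 0)) = 1 ∧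
        liminf (fun e => upperDetInf f x e) (nhdsWithin (0 : ℝ) (Set.Ioi 0)) = 0) := by
  exact ⟨pp.f 0, pp.C, eps, eps', pp.f_cont 0, fun x _ => pp.f_mem 0 x, pp.not_chaotic,
    fun n => ⟨_, pp.psi_mem 0 n 0 (pp.fp_mem n), pp.fp_period n⟩, pp.periods,
    pp.C_sub, pp.C_infinite, ⟨0, pp.C_zero⟩, pp.C_closed, pp.C_maps, pp.C_minimal,
    pp.unique_minimal, eps_anti, eps_pos, eps_tendsto, eps'_anti, eps'_pos, eps'_tendsto,
    fun x hx => ⟨pp_det1 hx, pp_det2 hx, pp_limsup hx, pp_liminf hx⟩⟩
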